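/- The number of pairs (A,B) ∈ ℤ² with max(|4A³|, 27B²) < X that are minimal (no prime p with p⁴|A and p⁶|B) and satisfy 4A³+27B² ≠ 0 is asymptotic to (2^{4/3}·3^{-3/2}/ζ(10)) · X^{5/6} as X → ∞. -/

import Mathlib

open Filter

namespace ECCount

open ArithmeticFunction

/-- The height of a pair. -/
def hgt (P : ℤ × ℤ) : ℤ := max |4 * P.1 ^ 3| (27 * P.2 ^ 2)

/-- `d` is a non-minimality witness. -/
def Div (d : ℕ) (P : ℤ × ℤ) : Prop := (d : ℤ) ^ 4 ∣ P.1 ∧ (d : ℤ) ^ 6 ∣ P.2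

lemma div_lcm {P : ℤ × ℤ} {d e : ℕ} (hd : Div d P) (he : Div e P) : Div (Nat.lcm d e) P := by
  unfold Div at *
  have key : ∀ (k : ℕ) (x : ℤ), (d : ℤ) ^ k ∣ x → (e : ℤ) ^ k ∣ x → ((Nat.lcm d e : ℕ) : ℤ) ^ k ∣ x := by
    intro k x h1 h2
    rw [← Nat.cast_pow, Int.natCast_dvd] at *
    rw [← Nat.pow_lcm_pow]
    exact Nat.lcm_dvd h1 h2
  exact ⟨key _ _ hd.1 he.1, key _ _ hd.2 he.2⟩

lemma div_of_dvd {P : ℤ × ℤ} {d e : ℕ} (h : d ∣ e) (he : Div e P) : Div d P := by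
  have h' : (d : ℤ) ∣ e := by exact_mod_cast h
  exact ⟨(pow_dvd_pow_of_dvd h' 4).trans he.1, (pow_dvd_pow_of_dvd h' 6).trans he.2⟩

open Classical in
lemma sum_moebius (P : ℤ × ℤ) (T : Finset ℕ) (hT : ∀ d, d ∈ T ↔ 1 ≤ d ∧ Div d P) :
    ∑ d ∈ T, moebius d = if ∃ p : ℕ, p.Prime ∧ Div p P then 0 else 1 := by
  have h1 : 1 ∈ T := by rw [hT]; simp [Div]
  obtain ⟨D, hD, hmax⟩ := Finset.exists_max_image T id ⟨1, h1⟩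
  have hD' := (hT D).1 hD
  have hTD : T = D.divisors := by
    ext d
    rw [Nat.mem_divisors]
    constructor
    · intro hd
      have hd' := (hT d).1 hd
      have hl : Nat.lcm d D ∈ T := by
        rw [hT]
        exact ⟨Nat.lcm_pos hd'.1 hD'.1, div_lcm hd'.2 hD'.2⟩
      have h2 : Nat.lcm d D ≤ D := hmax _ hl
      have h3 : D ∣ Nat.lcm d D := Nat.dvd_lcm_right _ _
      have h4 : Nat.lcm d D = D := Nat.dvd_antisymm (by
        have := Nat.le_of_dvd (Nat.lcm_pos hd'.1 hD'.1) h3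
        rw [le_antisymm h2 this]) h3
      exact ⟨h4 ▸ Nat.dvd_lcm_left d D, by omega⟩
    · rintro ⟨hd, h0⟩
      rw [hT]
      exact ⟨Nat.pos_of_dvd_of_pos hd hD'.1, div_of_dvd hd hD'.2⟩
  rw [hTD, ← coe_mul_zeta_apply, moebius_mul_coe_zeta, one_apply]
  by_cases h : D = 1
  · rw [if_pos h, if_neg]
    rintro ⟨p, hp, hpP⟩
    have : p ∈ T := by rw [hT]; exact ⟨hp.one_lt.le, hpP⟩
    have := hmax _ this
    have := hp.one_lt
    simp only [id] at *
    omega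
  · rw [if_neg h, if_pos]
    obtain ⟨p, hp, hpD⟩ := Nat.exists_prime_and_dvd h
    exact ⟨p, hp, div_of_dvd hpD hD'.2⟩

lemma abs_le_hgt (P : ℤ × ℤ) : |P.1| ≤ hgt P ∧ |P.2| ≤ hgt P := by
  unfold hgt
  constructor
  · refine le_trans ?_ (le_max_left _ _)
    rw [abs_mul, abs_pow]
    have := abs_nonneg P.1
    generalize |P.1| = x at *
    rcases eq_or_lt_of_le this with h | h
    · simp [← h]
    · have h1 : 1 ≤ x := h
      have : x ^ 1 ≤ x ^ 3 := pow_le_pow_right₀ h1 (by norm_num)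
      norm_num
      nlinarith
  · refine le_trans ?_ (le_max_right _ _)
    rw [← sq_abs]
    have := abs_nonneg P.2
    generalize |P.2| = x at *
    nlinarith

open Classical in
/-- Pairs of height less than `X`. -/
noncomputable def box (X : ℝ) : Finset (ℤ × ℤ) :=
  ((Finset.Icc (-⌈X⌉) ⌈X⌉) ×ˢ (Finset.Icc (-⌈X⌉) ⌈X⌉)).filter (fun P => (hgt P : ℝ) < X)

lemma mem_box {X : ℝ} {P : ℤ × ℤ} : P ∈ box X ↔ (hgt P : ℝ) < X := by
  unfold box
  rw [Finset.mem_filter]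
  refine ⟨fun h => h.2, fun h => ⟨?_, h⟩⟩
  have h1 : hgt P < ⌈X⌉ := Int.lt_ceil.2 h
  have := abs_le_hgt P
  rw [Finset.mem_product, Finset.mem_Icc, Finset.mem_Icc, ← abs_le, ← abs_le]
  omega

open Classical in
/-- number of nonzero pairs. -/
noncomputable def N (X : ℝ) : ℕ := ((box X).filter (· ≠ 0)).card

lemma hgt_scale (d : ℕ) (a b : ℤ) :
    hgt ((d : ℤ) ^ 4 * a, (d : ℤ) ^ 6 * b) = (d : ℤ) ^ 12 * hgt (a, b) := by
  unfold hgt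
  simp only
  rw [mul_max_of_nonneg _ _ (by positivity)]
  congr 1
  · rw [show 4 * ((d : ℤ) ^ 4 * a) ^ 3 = (d : ℤ) ^ 12 * (4 * a ^ 3) by ring, abs_mul,
      abs_of_nonneg (show (0 : ℤ) ≤ (d : ℤ) ^ 12 by positivity)]
  · ring

open Classical in
lemma card_scale (X : ℝ) (d : ℕ) (hd : 1 ≤ d) :
    ((box X).filter (fun P => P ≠ 0 ∧ Div d P)).card = N (X / (d : ℝ) ^ 12) := by
  unfold N
  symm
  have hd0 : (d : ℤ) ≠ 0 := by positivity
  have hdr : (0 : ℝ) < (d : ℝ) ^ 12 := by positivity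
  refine Finset.card_bij (fun P _ => ((d : ℤ) ^ 4 * P.1, (d : ℤ) ^ 6 * P.2)) ?_ ?_ ?_
  · rintro ⟨a, b⟩ h
    simp only [Finset.mem_filter, mem_box] at h ⊢
    refine ⟨?_, ?_, ?_⟩
    · rw [hgt_scale, ]
      have := (lt_div_iff₀ hdr).1 h.1
      push_cast
      linarith
    · intro h0
      apply h.2
      simpa [Prod.ext_iff, hd0, show d ≠ 0 by omega] using h0
    · exact ⟨dvd_mul_right _ _, dvd_mul_right _ _⟩
  · rintro ⟨a, b⟩ _ ⟨a', b'⟩ _ h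
    simpa [Prod.ext_iff, hd0, show d ≠ 0 by omega] using h
  · rintro ⟨a, b⟩ h
    simp only [Finset.mem_filter, mem_box] at h
    obtain ⟨h1, h2, ⟨a', ha⟩, ⟨b', hb⟩⟩ := h
    simp only at ha hb
    subst ha hb
    refine ⟨(a', b'), ?_, rfl⟩
    simp only [Finset.mem_filter, mem_box]
    constructor
    · rw [lt_div_iff₀ hdr]
      rw [hgt_scale] at h1
      push_cast at h1
      linarith
    · intro h0
      apply h2
      simp only [Prod.ext_iff, Prod.fst_zero, Prod.snd_zero] at h0 ⊢
      simp [h0.1, h0.2]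

lemma one_le_hgt {P : ℤ × ℤ} (h : P ≠ 0) : 1 ≤ hgt P := by
  have := abs_le_hgt P
  by_contra hc
  apply h
  have h1 : |P.1| ≤ 0 := by omega
  have h2 : |P.2| ≤ 0 := by omega
  exact Prod.ext (abs_nonpos_iff.1 h1) (abs_nonpos_iff.1 h2)

lemma N_eq_zero {X : ℝ} (h : X ≤ 1) : N X = 0 := by
  classical
  unfold N
  rw [Finset.card_eq_zero, Finset.filter_eq_empty_iff]
  intro P hP h0
  rw [mem_box] at hP
  have : (1 : ℝ) ≤ hgt P := by exact_mod_cast one_le_hgt h0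
  linarith

open Classical in
/-- number of minimal pairs. -/
noncomputable def M (X : ℝ) : ℕ :=
  ((box X).filter (fun P => ¬ ∃ p : ℕ, p.Prime ∧ Div p P)).card

lemma N_scale_zero {X : ℝ} (d : ℕ) (hd : ⌈X⌉₊ < d) : N (X / (d : ℝ) ^ 12) = 0 := by
  apply N_eq_zero
  have hd1 : 1 ≤ d := by omega
  have hdr : (1 : ℝ) ≤ (d : ℝ) := by exact_mod_cast hd1
  rw [div_le_one (by positivity)]
  have h1 : X ≤ d := (Nat.le_ceil X).trans (by exact_mod_cast hd.le)
  calc X ≤ (d : ℝ) ^ 1 := by simpa using h1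
    _ ≤ (d : ℝ) ^ 12 := pow_le_pow_right₀ hdr (by norm_num)

lemma M_eq_sum (X : ℝ) :
    (M X : ℤ) = ∑ d ∈ Finset.Icc 1 ⌈X⌉₊, moebius d * (N (X / (d : ℝ) ^ 12) : ℤ) := by
  classical
  have e1 : ∀ d ∈ Finset.Icc 1 ⌈X⌉₊, moebius d * (N (X / (d : ℝ) ^ 12) : ℤ)
      = ∑ P ∈ (box X).filter (· ≠ 0), if Div d P then moebius d else 0 := by
    intro d hd
    rw [← card_scale X d (Finset.mem_Icc.1 hd).1, ← Finset.sum_filter, Finset.filter_filter,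
      Finset.sum_const, nsmul_eq_mul, mul_comm]
  rw [Finset.sum_congr rfl e1, Finset.sum_comm]
  have e2 : ∀ P ∈ (box X).filter (· ≠ 0),
      (∑ d ∈ Finset.Icc 1 ⌈X⌉₊, if Div d P then moebius d else 0) =
      if ∃ p : ℕ, p.Prime ∧ Div p P then 0 else 1 := by
    intro P hP
    rw [← Finset.sum_filter]
    apply sum_moebius
    intro d
    rw [Finset.mem_filter, Finset.mem_Icc]
    refine ⟨fun h => ⟨h.1.1, h.2⟩, fun h => ⟨⟨h.1, ?_⟩, h.2⟩⟩
    by_contra hc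
    push Not at hc
    have h0 := N_scale_zero d hc
    rw [← card_scale X d h.1, Finset.card_eq_zero, Finset.filter_eq_empty_iff] at h0
    rw [Finset.mem_filter] at hP
    exact h0 hP.1 ⟨hP.2, h.2⟩
  rw [Finset.sum_congr rfl e2]
  unfold M
  have e3 : (box X).filter (fun P => ¬ ∃ p : ℕ, p.Prime ∧ Div p P) =
     ((box X).filter (· ≠ 0)).filter (fun P => ¬ ∃ p : ℕ, p.Prime ∧ Div p P) := by
    ext P
    simp only [Finset.mem_filter]
    constructor
    · rintro ⟨h1, h2⟩
      refine ⟨⟨h1, ?_⟩, h2⟩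
      rintro rfl
      exact h2 ⟨2, Nat.prime_two, by simp [Div]⟩
    · rintro ⟨⟨h1, _⟩, h2⟩
      exact ⟨h1, h2⟩
  rw [e3, Finset.card_filter]
  push_cast
  apply Finset.sum_congr rfl
  intro P _
  split_ifs <;> simp_all

lemma M_eq_tsum (X : ℝ) :
    (M X : ℂ) = ∑' d : ℕ, (moebius d : ℂ) * (N (X / (d : ℝ) ^ 12) : ℂ) := by
  rw [tsum_eq_sum (s := Finset.Icc 1 ⌈X⌉₊)]
  · have := congrArg (Int.cast : ℤ → ℂ) (M_eq_sum X)
    push_cast at this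
    exact this
  · intro d hd
    rcases Nat.eq_zero_or_pos d with rfl | h
    · simp
    · rw [N_scale_zero d]
      · simp
      · by_contra hc
        exact hd (Finset.mem_Icc.2 ⟨h, by omega⟩)


/-- integers with absolute value less than `t`. -/
noncomputable def I (t : ℝ) : Finset ℤ := Finset.Icc (-((⌈t⌉₊ : ℤ) - 1)) ((⌈t⌉₊ : ℤ) - 1)

lemma mem_I {t : ℝ} {n : ℤ} : n ∈ I t ↔ (|n| : ℝ) < t := by
  unfold I
  rw [Finset.mem_Icc, ← abs_le]
  have h : (|n| : ℝ) < t ↔ n.natAbs < ⌈t⌉₊ := by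
    rw [Nat.lt_ceil, Nat.cast_natAbs, Int.cast_abs]
  rw [h, Int.abs_eq_natAbs]
  omega

lemma card_I {t : ℝ} (ht : 0 < t) : ((I t).card : ℝ) = 2 * ⌈t⌉₊ - 1 := by
  have h : 0 < ⌈t⌉₊ := Nat.ceil_pos.2 ht
  unfold I
  rw [Int.card_Icc]
  have : (((⌈t⌉₊ : ℤ) - 1 + 1 - -((⌈t⌉₊ : ℤ) - 1)).toNat : ℤ) = 2 * ⌈t⌉₊ - 1 := by omega
  exact_mod_cast congrArg (Int.cast : ℤ → ℝ) this

lemma card_I_le {t : ℝ} (ht : 0 < t) : ((I t).card : ℝ) ≤ 2 * t + 1 := by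
  rw [card_I ht]
  have := Nat.ceil_lt_add_one ht.le
  linarith

lemma tendsto_card_I : Tendsto (fun t : ℝ => ((I t).card : ℝ) / t) atTop (nhds 2) := by
  have h1 := (tendsto_nat_ceil_div_atTop (R := ℝ)).const_mul 2
  have h2 := h1.sub (tendsto_inv_atTop_zero (𝕜 := ℝ))
  rw [show (2 : ℝ) * 1 - 0 = 2 by norm_num] at h2
  refine h2.congr' ?_
  filter_upwards [eventually_gt_atTop 0] with t ht
  rw [card_I ht]
  field_simp

noncomputable def ra (X : ℝ) : ℝ := (X / 4) ^ ((3 : ℝ)⁻¹)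
noncomputable def rb (X : ℝ) : ℝ := (X / 27) ^ ((2 : ℝ)⁻¹)

lemma box_eq {X : ℝ} (hX : 0 < X) : box X = I (ra X) ×ˢ I (rb X) := by
  ext ⟨m, n⟩
  rw [mem_box, Finset.mem_product, mem_I, mem_I]
  unfold hgt ra rb
  rw [Real.lt_rpow_inv_iff_of_pos (abs_nonneg _) (by positivity) (by norm_num),
    Real.lt_rpow_inv_iff_of_pos (abs_nonneg _) (by positivity) (by norm_num)]
  push_cast
  rw [max_lt_iff, abs_mul, abs_pow, lt_div_iff₀ (by norm_num), lt_div_iff₀ (by norm_num)]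
  rw [show (3 : ℝ) = ((3 : ℕ) : ℝ) by norm_num, show (2 : ℝ) = ((2 : ℕ) : ℝ) by norm_num,
    Real.rpow_natCast, Real.rpow_natCast, sq_abs, abs_of_pos (show (0 : ℝ) < 4 by norm_num),
    mul_comm (4 : ℝ), mul_comm (27 : ℝ)]

lemma card_N {X : ℝ} (hX : 0 < X) :
    (N X : ℝ) = ((I (ra X)).card : ℝ) * (I (rb X)).card - 1 := by
  classical
  have h0 : (0 : ℤ × ℤ) ∈ box X := by rw [mem_box]; simpa [hgt] using hX
  unfold N
  rw [Finset.filter_ne', Finset.card_erase_of_mem h0,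
    Nat.cast_sub (Finset.card_pos.2 ⟨_, h0⟩), box_eq hX, Finset.card_product]
  simp

/-- the constant -/
noncomputable def cc : ℝ := ((4 : ℝ) ^ ((3 : ℝ)⁻¹))⁻¹ * ((27 : ℝ) ^ ((2 : ℝ)⁻¹))⁻¹

lemma ra_eq {X : ℝ} (hX : 0 < X) : ra X = X ^ ((3 : ℝ)⁻¹) / (4 : ℝ) ^ ((3 : ℝ)⁻¹) := by
  unfold ra
  rw [Real.div_rpow hX.le (by norm_num)]

lemma rb_eq {X : ℝ} (hX : 0 < X) : rb X = X ^ ((2 : ℝ)⁻¹) / (27 : ℝ) ^ ((2 : ℝ)⁻¹) := by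
  unfold rb
  rw [Real.div_rpow hX.le (by norm_num)]

lemma pow_split {X : ℝ} (hX : 0 < X) :
    X ^ ((3 : ℝ)⁻¹) * X ^ ((2 : ℝ)⁻¹) = X ^ ((5 : ℝ) / 6) := by
  rw [← Real.rpow_add hX]
  norm_num

lemma ra_mul_rb {X : ℝ} (hX : 0 < X) : ra X * rb X = cc * X ^ ((5 : ℝ) / 6) := by
  rw [ra_eq hX, rb_eq hX, ← pow_split hX]
  unfold cc
  ring

lemma ra_pos {X : ℝ} (hX : 0 < X) : 0 < ra X := by unfold ra; positivity
lemma rb_pos {X : ℝ} (hX : 0 < X) : 0 < rb X := by unfold rb; positivity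

lemma tendsto_ra : Tendsto ra atTop atTop :=
  (tendsto_rpow_atTop (by norm_num)).comp (tendsto_id.atTop_div_const (by norm_num))
lemma tendsto_rb : Tendsto rb atTop atTop :=
  (tendsto_rpow_atTop (by norm_num)).comp (tendsto_id.atTop_div_const (by norm_num))

lemma tendsto_N :
    Tendsto (fun X : ℝ => (N X : ℝ) / X ^ ((5 : ℝ) / 6)) atTop (nhds (4 * cc)) := by
  have h1 := ((tendsto_card_I.comp tendsto_ra).mul (tendsto_card_I.comp tendsto_rb)).mul_const cc
  have h2 := h1.sub (tendsto_inv_atTop_zero.comp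
    (tendsto_rpow_atTop (show (0 : ℝ) < 5 / 6 by norm_num)))
  rw [show (2 : ℝ) * 2 * cc - 0 = 4 * cc by ring] at h2
  refine h2.congr' ?_
  filter_upwards [eventually_gt_atTop 0] with X hX
  simp only [Function.comp]
  rw [card_N hX]
  have h := ra_mul_rb hX
  have hp : 0 < X ^ ((5 : ℝ) / 6) := by positivity
  have ha := ra_pos hX
  have hb := rb_pos hX
  have hc : cc = ra X * rb X / X ^ ((5 : ℝ) / 6) := by rw [h]; field_simp
  rw [hc]
  field_simp

lemma N_le {X : ℝ} (hX : 0 < X) : (N X : ℝ) ≤ 9 * X ^ ((5 : ℝ) / 6) := by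
  rcases le_or_gt X 1 with h | h
  · rw [N_eq_zero h]
    simp only [Nat.cast_zero]
    positivity
  · rw [card_N hX]
    have ha := card_I_le (ra_pos hX)
    have hb := card_I_le (rb_pos hX)
    have h1 : ra X ≤ X ^ ((3 : ℝ)⁻¹) := by
      unfold ra
      exact Real.rpow_le_rpow (by positivity) (by linarith) (by norm_num)
    have h2 : rb X ≤ X ^ ((2 : ℝ)⁻¹) := by
      unfold rb
      exact Real.rpow_le_rpow (by positivity) (by linarith) (by norm_num)
    have h3 : 1 ≤ X ^ ((3 : ℝ)⁻¹) := Real.one_le_rpow h.le (by norm_num)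
    have h4 : 1 ≤ X ^ ((2 : ℝ)⁻¹) := Real.one_le_rpow h.le (by norm_num)
    have h5 := mul_le_mul (show ((I (ra X)).card : ℝ) ≤ 3 * X ^ ((3 : ℝ)⁻¹) by linarith)
      (show ((I (rb X)).card : ℝ) ≤ 3 * X ^ ((2 : ℝ)⁻¹) by linarith) (by positivity) (by positivity)
    rw [← pow_split hX]
    linarith

lemma scale_rpow {X : ℝ} (hX : 0 < X) (d : ℕ) :
    (X / (d : ℝ) ^ 12) ^ ((5 : ℝ) / 6) = X ^ ((5 : ℝ) / 6) / (d : ℝ) ^ 10 := by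
  rw [Real.div_rpow hX.le (by positivity), ← Real.rpow_natCast, ← Real.rpow_natCast,
    ← Real.rpow_mul (by positivity)]
  norm_num

lemma tendsto_term (d : ℕ) (hd : 1 ≤ d) :
    Tendsto (fun X : ℝ => (N (X / (d : ℝ) ^ 12) : ℝ) / X ^ ((5 : ℝ) / 6)) atTop
      (nhds (4 * cc / (d : ℝ) ^ 10)) := by
  have hd0 : (0 : ℝ) < (d : ℝ) := by exact_mod_cast hd
  have h := (tendsto_N.comp (tendsto_id.atTop_div_const
    (show (0 : ℝ) < (d : ℝ) ^ 12 by positivity))).div_const ((d : ℝ) ^ 10)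
  refine h.congr' ?_
  filter_upwards [eventually_gt_atTop 0] with X hX
  simp only [Function.comp, id]
  rw [scale_rpow hX]
  have hp : 0 < X ^ ((5 : ℝ) / 6) := by positivity
  field_simp

lemma bound_term {X : ℝ} (hX : 0 < X) (d : ℕ) (hd : 1 ≤ d) :
    (N (X / (d : ℝ) ^ 12) : ℝ) / X ^ ((5 : ℝ) / 6) ≤ 9 / (d : ℝ) ^ 10 := by
  have hd0 : (0 : ℝ) < (d : ℝ) := by exact_mod_cast hd
  have h := N_le (show 0 < X / (d : ℝ) ^ 12 by positivity)
  rw [scale_rpow hX] at h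
  have hp : 0 < X ^ ((5 : ℝ) / 6) := by positivity
  rw [div_le_iff₀ hp]
  calc _ ≤ _ := h
    _ = _ := by ring

lemma tsum_moebius : ∑' d : ℕ, (moebius d : ℂ) * ((4 * cc / (d : ℝ) ^ 10 : ℝ) : ℂ)
    = ((4 * cc : ℝ) : ℂ) / riemannZeta 10 := by
  have hre : 1 < (10 : ℂ).re := by norm_num
  have h := LSeries_zeta_mul_Lseries_moebius hre
  rw [LSeries_zeta_eq_riemannZeta hre] at h
  rw [div_eq_mul_inv, ← eq_inv_of_mul_eq_one_right h, LSeries, ← tsum_mul_left]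
  apply tsum_congr
  intro d
  rcases Nat.eq_zero_or_pos d with rfl | hd
  · simp
  · rw [LSeries.term_of_ne_zero (by omega)]
    rw [show (10 : ℂ) = ((10 : ℕ) : ℂ) by norm_num, Complex.cpow_natCast]
    push_cast
    ring

lemma tendsto_M :
    Tendsto (fun X : ℝ => (M X : ℂ) / ((X ^ ((5 : ℝ) / 6) : ℝ) : ℂ)) atTop
      (nhds (((4 * cc : ℝ) : ℂ) / riemannZeta 10)) := by
  rw [← tsum_moebius]
  have hs : Summable (fun d : ℕ => 9 / (d : ℝ) ^ 10) := by
    have := (Real.summable_one_div_nat_pow (p := 10)).2 (by norm_num)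
    simpa [div_eq_mul_inv] using this.mul_left 9
  have := tendsto_tsum_of_dominated_convergence (𝓕 := atTop)
    (f := fun (X : ℝ) (d : ℕ) => (moebius d : ℂ) *
      (((N (X / (d : ℝ) ^ 12) : ℝ) / X ^ ((5 : ℝ) / 6) : ℝ) : ℂ))
    (g := fun d : ℕ => (moebius d : ℂ) * ((4 * cc / (d : ℝ) ^ 10 : ℝ) : ℂ)) hs ?_ ?_
  · refine this.congr fun X => ?_
    rw [M_eq_tsum, ← tsum_div_const]
    apply tsum_congr
    intro d
    push_cast
    ring
  · intro d
    rcases Nat.eq_zero_or_pos d with rfl | hd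
    · simp
    · exact ((Complex.continuous_ofReal.tendsto _).comp (tendsto_term d hd)).const_mul _
  · filter_upwards [eventually_gt_atTop 0] with X hX d
    rcases Nat.eq_zero_or_pos d with rfl | hd
    · simp
    · rw [norm_mul, Complex.norm_real, Real.norm_of_nonneg (by positivity)]
      have h1 : ‖(moebius d : ℂ)‖ ≤ 1 := by
        rw [Complex.norm_intCast]
        exact_mod_cast abs_moebius_le_one
      calc _ ≤ 1 * (9 / (d : ℝ) ^ 10) :=
            mul_le_mul h1 (bound_term hX d hd) (by positivity) (by norm_num)
        _ = _ := one_mul _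

open Classical in
/-- minimal singular pairs -/
noncomputable def Sg (X : ℝ) : ℕ :=
  ((box X).filter (fun P => (¬ ∃ p : ℕ, p.Prime ∧ Div p P) ∧ 4 * P.1 ^ 3 + 27 * P.2 ^ 2 = 0)).card

lemma Sg_le {X : ℝ} (hX : 0 < X) : Sg X ≤ (I (rb X)).card := by
  classical
  unfold Sg
  refine Finset.card_le_card_of_injOn Prod.snd ?_ ?_
  · intro P hP
    have hP := Finset.mem_coe.1 hP
    rw [Finset.mem_filter, box_eq hX, Finset.mem_product] at hP
    exact hP.1.2
  · rintro ⟨a, b⟩ h ⟨a', b'⟩ h' hb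
    have h := (Finset.mem_filter.1 (Finset.mem_coe.1 h)).2.2
    have h' := (Finset.mem_filter.1 (Finset.mem_coe.1 h')).2.2
    simp only at h h' hb
    subst hb
    have : a ^ 3 = a' ^ 3 := by linarith
    rw [(Odd.strictMono_pow (show Odd 3 by decide)).injective this]

lemma tendsto_Sg :
    Tendsto (fun X : ℝ => (Sg X : ℝ) / X ^ ((5 : ℝ) / 6)) atTop (nhds 0) := by
  have h1 : Tendsto (fun X : ℝ => 3 * (X ^ (-((3 : ℝ)⁻¹)))) atTop (nhds (3 * 0)) :=
    (tendsto_rpow_neg_atTop (by norm_num)).const_mul 3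
  rw [mul_zero] at h1
  refine squeeze_zero' ?_ ?_ h1
  · filter_upwards [eventually_gt_atTop 0] with X hX
    positivity
  · filter_upwards [eventually_gt_atTop 1] with X hX1
    have hX : 0 < X := by linarith
    have hp : 0 < X ^ ((5 : ℝ) / 6) := by positivity
    rw [div_le_iff₀ hp, mul_assoc, ← Real.rpow_add hX,
      show -((3 : ℝ)⁻¹) + 5 / 6 = 2⁻¹ by norm_num]
    have h2 : (Sg X : ℝ) ≤ (I (rb X)).card := by exact_mod_cast Sg_le hX
    have hb := card_I_le (rb_pos hX)
    have h3 : rb X ≤ X ^ ((2 : ℝ)⁻¹) := by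
      unfold rb
      exact Real.rpow_le_rpow (by positivity) (by linarith) (by norm_num)
    have h4 : 1 ≤ X ^ ((2 : ℝ)⁻¹) := Real.one_le_rpow hX1.le (by norm_num)
    linarith

lemma card_eq (X : ℝ) : (Nat.card {P : ℤ × ℤ //
            ((max |4 * P.1 ^ 3| (27 * P.2 ^ 2) : ℤ) : ℝ) < X ∧
            (¬ ∃ p : ℕ, p.Prime ∧ (p : ℤ) ^ 4 ∣ P.1 ∧ (p : ℤ) ^ 6 ∣ P.2) ∧
            4 * P.1 ^ 3 + 27 * P.2 ^ 2 ≠ 0}) + Sg X = M X := by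
  classical
  rw [Nat.subtype_card (((box X).filter (fun P => ¬ ∃ p : ℕ, p.Prime ∧ Div p P)).filter
    (fun P => ¬ (4 * P.1 ^ 3 + 27 * P.2 ^ 2 = 0)))]
  · unfold Sg M
    rw [← Finset.filter_filter, add_comm]
    exact Finset.card_filter_add_card_filter_not _
  · intro P
    rw [Finset.mem_filter, Finset.mem_filter, mem_box, and_assoc]
    rfl

lemma cc_eq : ((4 * cc : ℝ) : ℂ) = (2 : ℂ) ^ ((4 : ℂ) / 3) * (3 : ℂ) ^ (-(3 : ℂ) / 2) := by
  have h2 : (2 : ℂ) ^ ((4 : ℂ) / 3) = (((2 : ℝ) ^ ((4 : ℝ) / 3) : ℝ) : ℂ) := by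
    rw [Complex.ofReal_cpow (by norm_num)]; push_cast; rfl
  have h3 : (3 : ℂ) ^ (-(3 : ℂ) / 2) = (((3 : ℝ) ^ (-(3 : ℝ) / 2) : ℝ) : ℂ) := by
    rw [Complex.ofReal_cpow (by norm_num)]; push_cast; rfl
  rw [h2, h3, ← Complex.ofReal_mul]
  congr 1
  unfold cc
  rw [← Real.rpow_neg (by norm_num), ← Real.rpow_neg (by norm_num), ← mul_assoc]
  congr 1
  · rw [show (4 : ℝ) ^ (-(3 : ℝ)⁻¹) = (2 : ℝ) ^ (-(2 : ℝ) / 3) by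
      rw [show (4 : ℝ) = (2 : ℝ) ^ (2 : ℝ) by norm_num, ← Real.rpow_mul (by norm_num)]
      norm_num]
    rw [show (4 : ℝ) = (2 : ℝ) ^ (2 : ℝ) by norm_num, ← Real.rpow_add (by norm_num)]
    norm_num
  · rw [show (27 : ℝ) = (3 : ℝ) ^ (3 : ℝ) by norm_num, ← Real.rpow_mul (by norm_num)]
    norm_num

end ECCount

theorem count_elliptic_curves_asymptotic :
    Tendsto
      (fun X : ℝ =>
        (Nat.card {P : ℤ × ℤ //
            ((max |4 * P.1 ^ 3| (27 * P.2 ^ 2) : ℤ) : ℝ) < X ∧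
            (¬ ∃ p : ℕ, p.Prime ∧ (p : ℤ) ^ 4 ∣ P.1 ∧ (p : ℤ) ^ 6 ∣ P.2) ∧
            4 * P.1 ^ 3 + 27 * P.2 ^ 2 ≠ 0} : ℂ) / (X : ℂ) ^ ((5 : ℂ) / 6))
      atTop
      (nhds ((2 : ℂ) ^ ((4 : ℂ) / 3) * (3 : ℂ) ^ (-(3 : ℂ) / 2) / riemannZeta 10)) := by
  have h := ECCount.tendsto_M.sub
    ((Complex.continuous_ofReal.tendsto _).comp ECCount.tendsto_Sg)
  rw [Complex.ofReal_zero, sub_zero, ECCount.cc_eq] at h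
  refine h.congr' ?_
  filter_upwards [eventually_gt_atTop 0] with X hX
  have e : (X : ℂ) ^ ((5 : ℂ) / 6) = ((X ^ ((5 : ℝ) / 6) : ℝ) : ℂ) := by
    rw [Complex.ofReal_cpow hX.le]; push_cast; rfl
  rw [e, ← ECCount.card_eq X]
  simp only [Function.comp]
  push_cast
  ring
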